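/- For all f, g, h ∈ A, the Jacobiator of the Jacobi bracket {f,g} = Λ(f,g) + f·R(g) − g·R(f) satisfies the identity {f,{g,h}} + {g,{h,f}} + {h,{f,g}} = −(Λ(Λ(f,g),h) + Λ(Λ(g,h),f) + Λ(Λ(h,f),g)) + (R(f)·Λ(g,h) + R(g)·Λ(h,f) + R(h)·Λ(f,g)) + f·C(g,h) + g·C(h,f) + h·C(f,g), where C(f,g) := R(Λ(f,g)) − Λ(R(f),g) − Λ(f,R(g)). (This identity is the bracket-level form of the computation in Proposition 3.3, ι_{[Q,Q]}α = [Λ,Λ] − 2RΛ + 2θ[R,Λ].) -/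

import Mathlib

/-- The Jacobiator of the Jacobi bracket `{f,g} = Λ(f,g) + f·R(g) − g·R(f)`
equals `−(cyclic Λ∘Λ) + (cyclic R·Λ) + (cyclic f·C)` where
`C(f,g) = R(Λ(f,g)) − Λ(R(f),g) − Λ(f,R(g))`. -/
theorem jacobi_bracket_jacobiator
    (A : Type*) [CommRing A] [Algebra ℝ A]
    (Λ : A →ₗ[ℝ] A →ₗ[ℝ] A) (hΛ0 : ∀ f : A, Λ f f = 0)
    (hΛd : ∀ f g h : A, Λ f (g * h) = g * Λ f h + h * Λ f g)
    (R : A →ₗ[ℝ] A) (hR : ∀ f g : A, R (f * g) = f * R g + g * R f)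
    (J : A → A → A) (hJ : ∀ f g : A, J f g = Λ f g + f * R g - g * R f)
    (C : A → A → A) (hC : ∀ f g : A, C f g = R (Λ f g) - Λ (R f) g - Λ f (R g)) :
    ∀ f g h : A,
      J f (J g h) + J g (J h f) + J h (J f g) =
        -(Λ (Λ f g) h + Λ (Λ g h) f + Λ (Λ h f) g)
        + (R f * Λ g h + R g * Λ h f + R h * Λ f g)
        + f * C g h + g * C h f + h * C f g := by
  have hanti : ∀ x y : A, Λ x y = -Λ y x := fun x y => by
    have h := hΛ0 (x + y)
    simp only [map_add, LinearMap.add_apply, hΛ0, zero_add, add_zero] at h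
    linear_combination h
  intro f g h
  simp only [hJ, hC, map_add, map_sub, hΛd, hR]
  rw [hanti f (Λ g h), hanti g (Λ h f), hanti h (Λ f g), hanti f (R g), hanti g (R h),
    hanti h (R f), hanti f (R h), hanti g (R f), hanti h (R g), hanti g f, hanti h g, hanti f h]
  ring
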